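/- Let a < b, let J = (a,b)×{0}, let V ⊂ ℝ_τ×(ℝ_{>0})_φ be a domain adjacent to J, and let F̃ : V ∪ J → ℝ×ℝ_{≥0} be a C^∞-smooth map of the form F̃(τ,φ) = (τ + φ + f₁(τ,φ), φ + f₂(τ,φ)) with f₁, f₂ φ-flat. Then there exist a domain W ⊆ V adjacent to J and a family (φ̃_ε)_{ε ∈ [0,1]} of C^∞-smooth functions on W ∪ J such that: each φ̃_ε is F̃-invariant, φ̃_ε − φ is φ-flat and ∂φ̃_ε/∂φ > 0 on W ∪ J; and for every ε ≠ ε′ in [0,1] and every point x ∈ J, the germs of φ̃_ε and of φ̃_{ε′} at x are distinct. -/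

import Mathlib

open Set

/-- `J = (a,b) × {0} ⊂ ℝ²`. -/
def Jset (a b : ℝ) : Set (ℝ × ℝ) := Set.Ioo a b ×ˢ ({0} : Set ℝ)

/-- A domain (connected open set) in the upper half-plane adjacent to the
interval `J = (a,b) × {0}`. -/
def IsAdjDomain (a b : ℝ) (V : Set (ℝ × ℝ)) : Prop :=
  IsOpen V ∧ IsConnected V ∧ (∀ p ∈ V, 0 < p.2) ∧
    ∀ s ∈ Set.Ioo a b, ∃ ε > 0, Set.Ioo (s - ε) (s + ε) ×ˢ Set.Ioo (0 : ℝ) ε ⊆ V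

/-- A function `f` on `S` (typically `S = V ∪ J`) is `φ`-flat: it vanishes on `J`,
and it tends to `0` together with each of its partial derivatives of every order,
as the second coordinate tends to `0`, uniformly on compact subsets of `(a,b)`. -/
def FlatOn (a b : ℝ) (S : Set (ℝ × ℝ)) (f : ℝ × ℝ → ℝ) : Prop :=
  (∀ s ∈ Set.Ioo a b, f (s, 0) = 0) ∧
  ∀ (n : ℕ) (K : Set ℝ), IsCompact K → K ⊆ Set.Ioo a b →
    ∀ ε > 0, ∃ δ > 0, ∀ p ∈ S, p.1 ∈ K → p.2 < δ →
      ‖iteratedFDerivWithin ℝ n f S p‖ < ε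

open Filter Topology

theorem closure_upper_half_plane :
    closure {p : ℝ × ℝ | 0 < p.2} = {p : ℝ × ℝ | 0 ≤ p.2} := by
  have h1 : {p : ℝ × ℝ | 0 < p.2} = univ ×ˢ Ioi 0 := by ext p; simp
  have h2 : {p : ℝ × ℝ | 0 ≤ p.2} = univ ×ˢ Ici 0 := by ext p; simp
  rw [h1, h2, closure_prod_eq, closure_univ, closure_Ioi]

theorem closure_lower_half_plane :
    closure {p : ℝ × ℝ | p.2 < 0} = {p : ℝ × ℝ | p.2 ≤ 0} := by
  have h1 : {p : ℝ × ℝ | p.2 < 0} = univ ×ˢ Iio 0 := by ext p; simp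
  have h2 : {p : ℝ × ℝ | p.2 ≤ 0} = univ ×ˢ Iic 0 := by ext p; simp
  rw [h1, h2, closure_prod_eq, closure_univ, closure_Iio]

theorem isOpen_upper_half_plane : IsOpen {p : ℝ × ℝ | 0 < p.2} :=
  isOpen_lt continuous_const continuous_snd

theorem isOpen_lower_half_plane : IsOpen {p : ℝ × ℝ | p.2 < 0} :=
  isOpen_lt continuous_snd continuous_const

/-- A function vanishing on the lower half-plane whose derivative tends to zero at a boundary
point, coming from the upper half-plane, has zero derivative at that point. -/
theorem hasFDerivAt_zero_of_tendsto_fderiv {E : Type} [NormedAddCommGroup E] [NormedSpace ℝ E]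
    {U : Set (ℝ × ℝ)} (hU : IsOpen U) {g : ℝ × ℝ → E}
    (h0 : ∀ p ∈ U, p.2 ≤ 0 → g p = 0)
    (hd : DifferentiableOn ℝ g (U ∩ {p | 0 < p.2}))
    (hc : ∀ x ∈ U, x.2 = 0 → Tendsto g (𝓝[{p | 0 < p.2}] x) (𝓝 0))
    {x : ℝ × ℝ} (hx : x ∈ U) (hx2 : x.2 = 0)
    (hx' : Tendsto (fderiv ℝ g) (𝓝[{p | 0 < p.2}] x) (𝓝 0)) :
    HasFDerivAt g (0 : ℝ × ℝ →L[ℝ] E) x := by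
  obtain ⟨r, hr, hrU⟩ := Metric.nhds_basis_closedBall.mem_iff.1 (hU.mem_nhds hx)
  have hopen := isOpen_upper_half_plane
  have hconv : Convex ℝ {p : ℝ × ℝ | 0 < p.2} :=
    convex_halfSpace_gt (LinearMap.isLinear (LinearMap.snd ℝ ℝ ℝ)) 0
  have hup : HasFDerivWithinAt g (0 : ℝ × ℝ →L[ℝ] E)
      (closure (Metric.ball x r ∩ {p | 0 < p.2})) x := by
    refine hasFDerivWithinAt_closure_of_tendsto_fderiv
      (hd.mono (inter_subset_inter_left _ (Metric.ball_subset_closedBall.trans hrU)))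
      ((convex_ball x r).inter hconv) (Metric.isOpen_ball.inter hopen) ?_
      (hx'.mono_left (nhdsWithin_mono _ inter_subset_right))
    intro y hy
    have hyU : y ∈ U :=
      hrU (closure_minimal (inter_subset_left.trans Metric.ball_subset_closedBall)
        Metric.isClosed_closedBall hy)
    have hy2 : 0 ≤ y.2 := by
      have := closure_mono inter_subset_right hy
      rwa [closure_upper_half_plane] at this
    rcases hy2.eq_or_lt with h | h
    · have := hc y hyU h.symm
      rw [ContinuousWithinAt, h0 y hyU h.ge]
      exact this.mono_left (nhdsWithin_mono _ inter_subset_right)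
    · exact (hd.differentiableAt ((hU.inter hopen).mem_nhds
        ⟨hyU, h⟩)).continuousAt.continuousWithinAt
  have hlow : HasFDerivWithinAt g (0 : ℝ × ℝ →L[ℝ] E) (U ∩ {p | p.2 ≤ 0}) x :=
    (hasFDerivWithinAt_const (0 : E) x _).congr (fun p hp => h0 p hp.1 hp.2) (h0 x hx hx2.le)
  refine (hup.union hlow).hasFDerivAt ?_
  filter_upwards [Metric.ball_mem_nhds x hr] with p hp
  rcases le_or_gt p.2 0 with h | h
  · exact Or.inr ⟨hrU (Metric.ball_subset_closedBall hp), h⟩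
  · exact Or.inl (subset_closure ⟨hp, h⟩)

/-- A function that vanishes on the lower half-plane, is smooth on the upper half-plane and
all of whose derivatives tend to zero at the boundary is smooth. -/
theorem contDiffOn_of_flat {E : Type} [NormedAddCommGroup E] [NormedSpace ℝ E]
    {U : Set (ℝ × ℝ)} (hU : IsOpen U) {g : ℝ × ℝ → E}
    (h0 : ∀ p ∈ U, p.2 ≤ 0 → g p = 0)
    (hd : ContDiffOn ℝ (⊤ : ℕ∞) g (U ∩ {p | 0 < p.2}))
    (ht : ∀ (n : ℕ), ∀ x ∈ U, x.2 = 0 →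
      Tendsto (fun p => ‖iteratedFDeriv ℝ n g p‖) (𝓝[{p | 0 < p.2}] x) (𝓝 0)) :
    ContDiffOn ℝ (⊤ : ℕ∞) g U := by
  rw [contDiffOn_infty]
  intro m
  have hopen := isOpen_upper_half_plane
  induction m generalizing E g with
  | zero =>
    rw [Nat.cast_zero, contDiffOn_zero]
    intro y hyU
    refine ContinuousAt.continuousWithinAt ?_
    rcases lt_trichotomy y.2 0 with h | h | h
    · have : g =ᶠ[𝓝 y] fun _ => 0 := by
        filter_upwards [hU.mem_nhds hyU, isOpen_lower_half_plane.mem_nhds h] with p h1 h2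
        exact h0 p h1 (le_of_lt h2)
      exact this.continuousAt
    · have h1 := ht 0 y hyU h
      simp only [norm_iteratedFDeriv_zero] at h1
      have h1 := tendsto_zero_iff_norm_tendsto_zero.2 h1
      rw [ContinuousAt, h0 y hyU h.le]
      have h2 : Tendsto g (𝓝[{p | p.2 ≤ 0}] y) (𝓝 0) := by
        refine tendsto_const_nhds.congr' ?_
        filter_upwards [self_mem_nhdsWithin, mem_nhdsWithin_of_mem_nhds (hU.mem_nhds hyU)]
          with p h1 h2
        exact (h0 p h2 h1).symm
      have := h1.sup h2
      rw [← nhdsWithin_union] at this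
      have hu : ({p : ℝ × ℝ | 0 < p.2} ∪ {p | p.2 ≤ 0}) = univ := by
        ext p; simpa using lt_or_ge 0 p.2
      rwa [hu, nhdsWithin_univ] at this
    · exact (hd.contDiffAt ((hU.inter hopen).mem_nhds ⟨hyU, h⟩)).continuousAt
  | succ m ih =>
    rw [Nat.cast_succ, contDiffOn_succ_iff_fderiv_of_isOpen hU]
    have hdiff : DifferentiableOn ℝ g (U ∩ {p | 0 < p.2}) := hd.differentiableOn (by simp)
    have hb : ∀ x ∈ U, x.2 ≤ 0 → HasFDerivAt g (0 : ℝ × ℝ →L[ℝ] E) x := by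
      intro x hx hx2
      rcases hx2.lt_or_eq with h | h
      · have : g =ᶠ[𝓝 x] fun _ => 0 := by
          filter_upwards [hU.mem_nhds hx, isOpen_lower_half_plane.mem_nhds h] with p h1 h2
          exact h0 p h1 (le_of_lt h2)
        exact (hasFDerivAt_const (0 : E) x).congr_of_eventuallyEq this
      · refine hasFDerivAt_zero_of_tendsto_fderiv hU h0 hdiff ?_ hx h ?_
        · intro y hy hy2
          have h1 := ht 0 y hy hy2
          simp only [norm_iteratedFDeriv_zero] at h1
          exact tendsto_zero_iff_norm_tendsto_zero.2 h1
        · have h1 := ht 1 x hx h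
          simp only [← norm_iteratedFDeriv_fderiv, norm_iteratedFDeriv_zero] at h1
          exact tendsto_zero_iff_norm_tendsto_zero.2 h1
    refine ⟨?_, by simp, ?_⟩
    · intro x hx
      rcases le_or_gt x.2 0 with h | h
      · exact (hb x hx h).differentiableAt.differentiableWithinAt
      · exact (hdiff.differentiableAt
          ((hU.inter hopen).mem_nhds ⟨hx, h⟩)).differentiableWithinAt
    · refine ih (fun p hp hp2 => (hb p hp hp2).fderiv) ?_ ?_
      · exact hd.fderiv_of_isOpen (hU.inter hopen) (by simp)
      · intro n x hx hx2
        simpa only [norm_iteratedFDeriv_fderiv] using ht (n + 1) x hx hx2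

/-- A smooth function with bounded derivatives vanishing on the lower half-plane decays,
together with all its derivatives, faster than any power at the boundary. -/
theorem exists_norm_iteratedFDeriv_le_pow {E : Type} [NormedAddCommGroup E] [NormedSpace ℝ E]
    {g : ℝ × ℝ → E} (hg : ContDiff ℝ (⊤ : ℕ∞) g) (h0 : ∀ p, p.2 ≤ 0 → g p = 0)
    (hb : ∀ n : ℕ, ∃ C, ∀ p, ‖iteratedFDeriv ℝ n g p‖ ≤ C) (M n : ℕ) :
    ∃ C, 0 ≤ C ∧ ∀ p : ℝ × ℝ, 0 ≤ p.2 → ‖iteratedFDeriv ℝ n g p‖ ≤ C * p.2 ^ M := by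
  have hz : ∀ (n : ℕ) (p : ℝ × ℝ), p.2 ≤ 0 → iteratedFDeriv ℝ n g p = 0 := by
    intro n p hp
    have hcl : IsClosed {p | iteratedFDeriv ℝ n g p = 0} :=
      isClosed_eq (hg.continuous_iteratedFDeriv (by exact_mod_cast le_top)) continuous_const
    have hsub : {p : ℝ × ℝ | p.2 < 0} ⊆ {p | iteratedFDeriv ℝ n g p = 0} := by
      intro q hq
      have : g =ᶠ[𝓝 q] fun _ => 0 := by
        filter_upwards [isOpen_lower_half_plane.mem_nhds hq] with r hr using h0 r (le_of_lt hr)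
      have := (this.iteratedFDeriv ℝ n).eq_of_nhds
      simpa using this
    have := closure_minimal hsub hcl
    rw [closure_lower_half_plane] at this
    exact this hp
  induction M generalizing n with
  | zero =>
    obtain ⟨C, hC⟩ := hb n
    exact ⟨C, (norm_nonneg _).trans (hC 0), fun p _ => by simpa using hC p⟩
  | succ M ih =>
    obtain ⟨C, hC0, hC⟩ := ih (n + 1)
    refine ⟨C, hC0, fun p hp => ?_⟩
    have hconv : Convex ℝ ({q : ℝ × ℝ | 0 ≤ q.2} ∩ {q : ℝ × ℝ | q.2 ≤ p.2}) :=
      (convex_halfSpace_ge (LinearMap.isLinear (LinearMap.snd ℝ ℝ ℝ)) 0).inter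
        (convex_halfSpace_le (LinearMap.isLinear (LinearMap.snd ℝ ℝ ℝ)) p.2)
    have key := hconv.norm_image_sub_le_of_norm_fderiv_le (𝕜 := ℝ)
      (f := iteratedFDeriv ℝ n g) (C := C * p.2 ^ M) (x := (p.1, 0)) (y := p)
      (fun q _ => (hg.differentiable_iteratedFDeriv
        (by exact_mod_cast WithTop.coe_lt_top n)).differentiableAt)
      (fun q hq => by
        rw [norm_fderiv_iteratedFDeriv]
        refine (hC q hq.1).trans ?_
        have := hq.1
        have := hq.2
        simp only [mem_ofPred_eq] at *
        gcongr)
      ⟨le_refl (0 : ℝ), hp⟩ ⟨hp, le_refl p.2⟩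
    rw [hz n (p.1, 0) le_rfl, sub_zero] at key
    refine key.trans (le_of_eq ?_)
    have : ‖p - (p.1, 0)‖ = p.2 := by
      rw [Prod.norm_def]
      simp [abs_of_nonneg hp, hp]
    rw [this]
    ring

/-- Every open neighbourhood of `J` contains `W ∪ J` for a domain `W` adjacent to `J`;
moreover `W ∪ J` can be taken to be the intersection of an open set and the closed upper
half-plane. -/
theorem exists_adjDomain_subset {a b : ℝ} (hab : a < b) {O : Set (ℝ × ℝ)} (hO : IsOpen O)
    (hJ : Jset a b ⊆ O) :
    ∃ W : Set (ℝ × ℝ), IsAdjDomain a b W ∧ W ∪ Jset a b ⊆ O ∧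
      UniqueDiffOn ℝ (W ∪ Jset a b) := by
  set O' : Set (ℝ × ℝ) := O ∩ Ioo a b ×ˢ univ ∩ univ ×ˢ Iio 1 with hO'
  have hO'o : IsOpen O' :=
    (hO.inter (isOpen_Ioo.prod isOpen_univ)).inter (isOpen_univ.prod isOpen_Iio)
  have hJ' : ∀ s ∈ Ioo a b, ((s, 0) : ℝ × ℝ) ∈ O' := fun s hs =>
    ⟨⟨hJ ⟨hs, rfl⟩, hs, mem_univ _⟩, mem_univ _, by simp⟩
  have hne : (O'ᶜ).Nonempty := ⟨(0, 1), fun h => by simpa using h.2⟩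
  set w : ℝ → ℝ := fun s => Metric.infDist (s, 0) O'ᶜ with hw
  have hwc : Continuous w := (Metric.continuous_infDist_pt _).comp (by fun_prop)
  have hwpos : ∀ s ∈ Ioo a b, 0 < w s := fun s hs =>
    (hO'o.isClosed_compl.notMem_iff_infDist_pos hne).1 (fun h => h (hJ' s hs))
  have hmem : ∀ p : ℝ × ℝ, |p.2| < w p.1 → p ∈ O' := by
    intro p hp
    by_contra h
    have h1 : w p.1 ≤ dist ((p.1, 0) : ℝ × ℝ) p := Metric.infDist_le_dist_of_mem h
    rw [Prod.dist_eq] at h1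
    simp only [dist_self, Real.dist_eq, zero_sub, abs_neg] at h1
    rw [max_eq_right (abs_nonneg _)] at h1
    linarith
  set T : Set (ℝ × ℝ) := {p | |p.2| < w p.1} with hT
  have hTo : IsOpen T := isOpen_lt (by fun_prop) (by fun_prop)
  have hTJ : ∀ p ∈ T, p.1 ∈ Ioo a b := fun p hp => (hmem p hp).1.2.1
  refine ⟨T ∩ {p | 0 < p.2}, ⟨hTo.inter isOpen_upper_half_plane, ?_, fun p hp => hp.2, ?_⟩,
    ?_, ?_⟩
  · have himg : T ∩ {p | 0 < p.2} =
        (fun q : ℝ × ℝ => (q.1, q.2 * w q.1)) '' (Ioo a b ×ˢ Ioo 0 1) := by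
      ext p
      constructor
      · rintro ⟨h1, h2 : 0 < p.2⟩
        have h3 := hwpos _ (hTJ p h1)
        rw [hT, mem_ofPred_eq, abs_of_pos h2] at h1
        refine ⟨(p.1, p.2 / w p.1), ⟨hTJ p (by rwa [hT, mem_ofPred_eq, abs_of_pos h2]),
          by positivity, (div_lt_one h3).2 h1⟩, ?_⟩
        ext
        · rfl
        · simp [h3.ne']
      · rintro ⟨q, ⟨h1, h2, h3⟩, rfl⟩
        have h4 := hwpos _ h1
        have h5 : 0 < q.2 * w q.1 := mul_pos h2 h4
        refine ⟨?_, h5⟩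
        simp only [hT, mem_ofPred_eq, abs_of_pos h5]
        nlinarith
    rw [himg]
    refine IsConnected.image ?_ _ (by fun_prop)
    exact (isConnected_Ioo hab).prod (isConnected_Ioo one_pos)
  · intro s hs
    have hsT : ((s, 0) : ℝ × ℝ) ∈ T := by simpa [hT] using hwpos s hs
    obtain ⟨ε, hε, hεT⟩ := Metric.isOpen_iff.1 hTo _ hsT
    refine ⟨ε, hε, fun p hp => ⟨hεT ?_, hp.2.1⟩⟩
    rw [← ball_prod_same]
    refine ⟨?_, ?_⟩
    · rw [Real.ball_eq_Ioo]; exact hp.1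
    · rw [Real.ball_eq_Ioo]; exact ⟨by linarith [hp.2.1], by linarith [hp.2.2]⟩
  · rintro p (hp | hp)
    · exact (hmem p hp.1).1.1
    · exact hJ hp
  · have : T ∩ {p | 0 < p.2} ∪ Jset a b = {p : ℝ × ℝ | 0 ≤ p.2} ∩ T := by
      ext p
      constructor
      · rintro (hp | hp)
        · exact ⟨le_of_lt (show 0 < p.2 from hp.2), hp.1⟩
        · have h2 : p.2 = 0 := hp.2
          refine ⟨h2.ge, ?_⟩
          simpa [hT, h2] using hwpos _ hp.1
      · rintro ⟨h1, h2⟩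
        rcases (show 0 ≤ p.2 from h1).eq_or_lt with h | h
        · exact Or.inr ⟨hTJ p h2, h.symm⟩
        · exact Or.inl ⟨h2, h⟩
    rw [this]
    refine (uniqueDiffOn_convex
      (convex_halfSpace_ge (LinearMap.isLinear (LinearMap.snd ℝ ℝ ℝ)) 0) ⟨(0, 1), ?_⟩).inter hTo
    have hsub : {p : ℝ × ℝ | 0 < p.2} ⊆ {p | 0 ≤ p.2} := fun p (hp : 0 < p.2) =>
      show (0 : ℝ) ≤ p.2 from hp.le
    exact interior_maximal hsub isOpen_upper_half_plane (by simp)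

theorem continuousAt_iteratedFDeriv_of_contDiffOn {O : Set (ℝ × ℝ)} (hO : IsOpen O)
    {g : ℝ × ℝ → ℝ} (hg : ContDiffOn ℝ (⊤ : ℕ∞) g O) (n : ℕ) {x : ℝ × ℝ} (hx : x ∈ O) :
    ContinuousAt (iteratedFDeriv ℝ n g) x :=
  ((hg.contDiffAt (hO.mem_nhds hx)).iteratedFDeriv_right (m := 0)
    (by simp; exact_mod_cast le_top)).continuousAt

/-- All derivatives of a smooth function vanishing on the lower half-plane vanish on the
closed lower half-plane. -/
theorem iteratedFDeriv_eq_zero_of_forall_nonpos {O : Set (ℝ × ℝ)} (hO : IsOpen O)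
    {g : ℝ × ℝ → ℝ} (hg : ContDiffOn ℝ (⊤ : ℕ∞) g O) (h0 : ∀ p ∈ O, p.2 ≤ 0 → g p = 0)
    (n : ℕ) {x : ℝ × ℝ} (hx : x ∈ O) (hx2 : x.2 ≤ 0) : iteratedFDeriv ℝ n g x = 0 := by
  have hne : (𝓝[{p : ℝ × ℝ | p.2 < 0}] x).NeBot := by
    rw [← mem_closure_iff_nhdsWithin_neBot, closure_lower_half_plane]
    exact hx2
  refine tendsto_nhds_unique
    ((continuousAt_iteratedFDeriv_of_contDiffOn hO hg n hx).mono_left nhdsWithin_le_nhds :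
      Tendsto _ (𝓝[{p : ℝ × ℝ | p.2 < 0}] x) _) ?_
  refine tendsto_const_nhds.congr' ?_
  filter_upwards [self_mem_nhdsWithin, mem_nhdsWithin_of_mem_nhds (hO.mem_nhds hx)]
    with q hq hqO
  have : g =ᶠ[𝓝 q] fun _ => 0 := by
    filter_upwards [isOpen_lower_half_plane.mem_nhds hq, hO.mem_nhds hqO] with r hr hrO
      using h0 r hrO (le_of_lt hr)
  have := (this.iteratedFDeriv ℝ n).eq_of_nhds
  simpa using this.symm

theorem exists_open_norm_fderiv_lt {a b : ℝ} {O : Set (ℝ × ℝ)} (hO : IsOpen O)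
    (hJ : Jset a b ⊆ O) {g : ℝ × ℝ → ℝ} (hg : ContDiffOn ℝ (⊤ : ℕ∞) g O)
    (h0 : ∀ p ∈ O, p.2 ≤ 0 → g p = 0) {ε : ℝ} (hε : 0 < ε) :
    ∃ N : Set (ℝ × ℝ), IsOpen N ∧ Jset a b ⊆ N ∧ ∀ p ∈ N, ‖fderiv ℝ g p‖ < ε := by
  refine ⟨interior {p | ‖iteratedFDeriv ℝ 1 g p‖ < ε}, isOpen_interior, fun x hx => ?_,
    fun p hp => ?_⟩
  · have hx2 : x.2 = 0 := hx.2
    rw [mem_interior_iff_mem_nhds]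
    have := (continuousAt_iteratedFDeriv_of_contDiffOn hO hg 1 (hJ hx)).norm
    rw [ContinuousAt, iteratedFDeriv_eq_zero_of_forall_nonpos hO hg h0 1 (hJ hx) hx2.le,
      norm_zero] at this
    exact this.eventually_lt_const hε
  · rw [← norm_iteratedFDeriv_one]
    exact interior_subset (s := {p | ‖iteratedFDeriv ℝ 1 g p‖ < ε}) hp

/-- A function that is smooth near `J` and vanishes on the lower half-plane is `φ`-flat. -/
theorem flatOn_of_contDiffOn {a b : ℝ} {O S : Set (ℝ × ℝ)} (hO : IsOpen O) (hS : S ⊆ O)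
    (hJ : Jset a b ⊆ O) (hSu : UniqueDiffOn ℝ S) (hS0 : ∀ p ∈ S, 0 ≤ p.2) {g : ℝ × ℝ → ℝ}
    (hg : ContDiffOn ℝ (⊤ : ℕ∞) g O) (h0 : ∀ p ∈ O, p.2 ≤ 0 → g p = 0) :
    FlatOn a b S g := by
  refine ⟨fun s hs => h0 _ (hJ ⟨hs, rfl⟩) le_rfl, fun n K hK hKab ε hε => ?_⟩
  have hcont : ∀ x ∈ O, ContinuousAt (iteratedFDeriv ℝ n g) x := fun x hx =>
    continuousAt_iteratedFDeriv_of_contDiffOn hO hg n hx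
  have hz : ∀ x ∈ O, x.2 = 0 → iteratedFDeriv ℝ n g x = 0 := fun x hx hx2 =>
    iteratedFDeriv_eq_zero_of_forall_nonpos hO hg h0 n hx hx2.le
  set N : Set (ℝ × ℝ) := interior {p | ‖iteratedFDeriv ℝ n g p‖ < ε} with hN
  have hKN : K ×ˢ ({0} : Set ℝ) ⊆ N := by
    rintro x ⟨hx1, hx2⟩
    have hx2 : x.2 = 0 := hx2
    have hxO : x ∈ O := hJ ⟨hKab hx1, hx2⟩
    rw [hN, mem_interior_iff_mem_nhds]
    have := (hcont x hxO).norm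
    rw [ContinuousAt, hz x hxO hx2, norm_zero] at this
    exact this.eventually_lt_const hε
  obtain ⟨u, v, -, hv, hKu, h0v, huv⟩ :=
    generalized_tube_lemma hK isCompact_singleton isOpen_interior hKN
  obtain ⟨δ, hδ, hδv⟩ := Metric.isOpen_iff.1 hv 0 (h0v rfl)
  refine ⟨δ, hδ, fun p hp hpK hpδ => ?_⟩
  rw [iteratedFDerivWithin_eq_iteratedFDeriv hSu
    ((hg.contDiffAt (hO.mem_nhds (hS hp))).of_le (by exact_mod_cast le_top)) hp]
  have hpv : p.2 ∈ Metric.ball (0 : ℝ) δ := by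
    rw [Metric.mem_ball, Real.dist_eq, sub_zero, abs_of_nonneg (hS0 p hp)]
    exact hpδ
  have := interior_subset (huv ⟨hKu hpK, hδv hpv⟩)
  exact this

/-- The perturbation `(τ, φ) ↦ (τ + φ + f₁(τ, φ), φ + f₂(τ, φ))` of the unipotent shear. -/
def perturbedShear (f : ℝ × ℝ → ℝ × ℝ) (p : ℝ × ℝ) : ℝ × ℝ :=
  (p.1 + p.2 + (f p).1, p.2 + (f p).2)

theorem contDiff_iterate_perturbedShear {f : ℝ × ℝ → ℝ × ℝ} (hf : ContDiff ℝ (⊤ : ℕ∞) f)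
    (k : ℕ) : ContDiff ℝ (⊤ : ℕ∞) (perturbedShear f)^[k] := by
  have : ContDiff ℝ (⊤ : ℕ∞) (perturbedShear f) := by
    unfold perturbedShear
    fun_prop
  induction k with
  | zero => exact contDiff_id
  | succ k ih =>
    rw [Function.iterate_succ']
    exact this.comp ih

theorem iterate_perturbedShear_snd_of_nonpos {f : ℝ × ℝ → ℝ × ℝ}
    (h0 : ∀ p, p.2 ≤ 0 → f p = 0) {p : ℝ × ℝ} (hp : p.2 ≤ 0) (k : ℕ) :
    ((perturbedShear f)^[k] p).2 = p.2 := by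
  induction k with
  | zero => rfl
  | succ k ih =>
    rw [Function.iterate_succ_apply', perturbedShear, h0 _ (ih.trans_le hp), ih]
    simp

theorem iterate_perturbedShear_snd_of_le_fst {f : ℝ × ℝ → ℝ × ℝ} {b : ℝ}
    (hb : ∀ p, b ≤ p.1 → f p = 0) {p : ℝ × ℝ} (hp : b ≤ p.1) (hp2 : 0 ≤ p.2) (k : ℕ) :
    b ≤ ((perturbedShear f)^[k] p).1 ∧ ((perturbedShear f)^[k] p).2 = p.2 := by
  induction k with
  | zero => exact ⟨hp, rfl⟩
  | succ k ih =>
    rw [Function.iterate_succ_apply', perturbedShear, hb _ ih.1, ih.2]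
    constructor
    · simp only [Prod.fst_zero]
      linarith [ih.1]
    · simp

/-- Near the boundary, `O(1/φ)` iterates of a flat perturbation of the shear keep the second
coordinate comparable to its initial value and move the first one forward at speed `≥ φ / 4`. -/
theorem exists_iterate_perturbedShear_bounds {f : ℝ × ℝ → ℝ × ℝ} {C A : ℝ} (hC : 0 ≤ C)
    (hA : 0 ≤ A) (hf : ∀ p : ℝ × ℝ, 0 ≤ p.2 → ‖f p‖ ≤ C * p.2 ^ 3) :
    ∃ h > 0, h ≤ 1 ∧ ∀ p : ℝ × ℝ, 0 < p.2 → p.2 < h → ∀ k : ℕ, k * p.2 ≤ A →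
      p.2 / 2 ≤ ((perturbedShear f)^[k] p).2 ∧ ((perturbedShear f)^[k] p).2 ≤ 2 * p.2 ∧
      p.1 + k * p.2 / 4 ≤ ((perturbedShear f)^[k] p).1 := by
  have hD : 0 < 1 + 16 * C * A + 32 * C := by positivity
  refine ⟨1 / (1 + 16 * C * A + 32 * C), by positivity, ?_, ?_⟩
  · rw [div_le_one hD]
    have : 0 ≤ C * A := by positivity
    nlinarith
  intro p hp hph
  rw [lt_div_iff₀ hD] at hph
  have h1 : 16 * C * A * p.2 ≤ 1 := by nlinarith [mul_nonneg hC hp.le]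
  have h2 : 32 * C * p.2 ≤ 1 := by nlinarith [mul_nonneg (mul_nonneg hC hA) hp.le]
  have h3 : p.2 ≤ 1 := by
    nlinarith [mul_nonneg (mul_nonneg hC hA) hp.le, mul_nonneg hC hp.le]
  have h4 : 8 * C * p.2 ^ 3 ≤ p.2 / 4 := by
    have : p.2 ^ 3 ≤ p.2 ^ 2 := pow_le_pow_of_le_one hp.le h3 (by norm_num)
    have h5 := mul_le_mul_of_nonneg_left this hC
    nlinarith
  have h6 : ∀ k : ℕ, k * p.2 ≤ A → k * (8 * C * p.2 ^ 3) ≤ p.2 / 2 := by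
    intro k hk
    have : k * (8 * C * p.2 ^ 3) = (k * p.2) * (8 * C * p.2 ^ 2) := by ring
    rw [this]
    have : (k * p.2) * (8 * C * p.2 ^ 2) ≤ A * (8 * C * p.2 ^ 2) := by gcongr
    nlinarith
  have main : ∀ k : ℕ, k * p.2 ≤ A →
      |((perturbedShear f)^[k] p).2 - p.2| ≤ k * (8 * C * p.2 ^ 3) ∧
      p.1 + k * p.2 / 4 ≤ ((perturbedShear f)^[k] p).1 := by
    intro k
    induction k with
    | zero => simp
    | succ k ih =>
      intro hk
      push_cast at hk ⊢
      have hk' : k * p.2 ≤ A := by linarith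
      obtain ⟨i1, i2⟩ := ih hk'
      rw [Function.iterate_succ_apply']
      set q := (perturbedShear f)^[k] p with hq
      have i3 := abs_le.1 (i1.trans (h6 k hk'))
      have i4 : ‖f q‖ ≤ 8 * C * p.2 ^ 3 := by
        refine (hf q (by linarith [i3.1])).trans ?_
        have : q.2 ^ 3 ≤ (2 * p.2) ^ 3 :=
          pow_le_pow_left₀ (by linarith [i3.1]) (by linarith [i3.2]) 3
        have := mul_le_mul_of_nonneg_left this hC
        linarith
      have i5 := abs_le.1 (((norm_fst_le (f q)).trans i4 : |(f q).1| ≤ _))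
      have i6 : |(f q).2| ≤ _ := (norm_snd_le (f q)).trans i4
      simp only [perturbedShear]
      constructor
      · have : q.2 + (f q).2 - p.2 = (q.2 - p.2) + (f q).2 := by ring
        rw [this]
        refine (abs_add_le _ _).trans ?_
        linarith
      · linarith [i3.1, i5.1]
  intro k hk
  obtain ⟨m1, m2⟩ := main k hk
  have m3 := abs_le.1 (m1.trans (h6 k hk))
  exact ⟨by linarith [m3.1], by linarith [m3.2], m2⟩

theorem norm_iteratedFDeriv_continuousLinearMap_le {E F : Type*} [NormedAddCommGroup E]
    [NormedSpace ℝ E] [NormedAddCommGroup F] [NormedSpace ℝ F] (L : E →L[ℝ] F)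
    (x : E) {i : ℕ} (hi : 1 ≤ i) : ‖iteratedFDeriv ℝ i L x‖ ≤ ‖L‖ := by
  obtain ⟨j, rfl⟩ := Nat.exists_eq_add_of_le' hi
  rw [← norm_iteratedFDeriv_fderiv]
  have : fderiv ℝ L = fun _ => L := by ext1 y; exact L.fderiv
  rw [this]
  cases j with
  | zero => rw [norm_iteratedFDeriv_zero]
  | succ j => simp [iteratedFDeriv_succ_const]

theorem norm_iteratedFDeriv_fst_comp_le {E F G : Type*} [NormedAddCommGroup E]
    [NormedSpace ℝ E] [NormedAddCommGroup F] [NormedSpace ℝ F] [NormedAddCommGroup G]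
    [NormedSpace ℝ G] {g : E → F × G} (hg : ContDiff ℝ (⊤ : ℕ∞) g) (i : ℕ) (x : E) :
    ‖iteratedFDeriv ℝ i (fun y => (g y).1) x‖ ≤ ‖iteratedFDeriv ℝ i g x‖ := by
  refine ((ContinuousLinearMap.fst ℝ F G).norm_iteratedFDeriv_comp_left hg.contDiffAt
    (by exact_mod_cast le_top)).trans ?_
  exact mul_le_of_le_one_left (norm_nonneg _) (ContinuousLinearMap.norm_fst_le ..)

theorem norm_iteratedFDeriv_snd_comp_le {E F G : Type*} [NormedAddCommGroup E]
    [NormedSpace ℝ E] [NormedAddCommGroup F] [NormedSpace ℝ F] [NormedAddCommGroup G]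
    [NormedSpace ℝ G] {g : E → F × G} (hg : ContDiff ℝ (⊤ : ℕ∞) g) (i : ℕ) (x : E) :
    ‖iteratedFDeriv ℝ i (fun y => (g y).2) x‖ ≤ ‖iteratedFDeriv ℝ i g x‖ := by
  refine ((ContinuousLinearMap.snd ℝ F G).norm_iteratedFDeriv_comp_left hg.contDiffAt
    (by exact_mod_cast le_top)).trans ?_
  exact mul_le_of_le_one_left (norm_nonneg _) (ContinuousLinearMap.norm_snd_le ..)

theorem norm_iteratedFDeriv_add_le {E F : Type*} [NormedAddCommGroup E]
    [NormedSpace ℝ E] [NormedAddCommGroup F] [NormedSpace ℝ F] {g g' : E → F}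
    (hg : ContDiff ℝ (⊤ : ℕ∞) g) (hg' : ContDiff ℝ (⊤ : ℕ∞) g') (i : ℕ) (x : E) :
    ‖iteratedFDeriv ℝ i (fun y => g y + g' y) x‖ ≤
      ‖iteratedFDeriv ℝ i g x‖ + ‖iteratedFDeriv ℝ i g' x‖ := by
  have : (fun y => g y + g' y) = g + g' := rfl
  rw [this, iteratedFDeriv_add_apply (hg.contDiffAt.of_le (by exact_mod_cast le_top))
    (hg'.contDiffAt.of_le (by exact_mod_cast le_top))]
  exact norm_add_le _ _

/-- Derivatives of a flat map along `O(1/φ)` iterates of the corresponding perturbed shear. -/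
theorem exists_norm_iteratedFDeriv_comp_iterate_le {f : ℝ × ℝ → ℝ × ℝ}
    (hf : ContDiff ℝ (⊤ : ℕ∞) f)
    (hflat : ∀ M n : ℕ, ∃ C, 0 ≤ C ∧
      ∀ p : ℝ × ℝ, 0 ≤ p.2 → ‖iteratedFDeriv ℝ n f p‖ ≤ C * p.2 ^ M)
    {A : ℝ} (hA : 0 ≤ A) (n : ℕ) :
    ∃ h > 0, ∃ C, 0 ≤ C ∧ ∀ p : ℝ × ℝ, 0 < p.2 → p.2 < h → ∀ k : ℕ, k * p.2 ≤ A →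
      ∀ i ≤ n, ‖iteratedFDeriv ℝ i (f ∘ (perturbedShear f)^[k]) p‖ ≤ C * p.2 ^ 2 := by
  obtain ⟨C₀, hC₀, hf₀⟩ := hflat 3 0
  simp only [norm_iteratedFDeriv_zero] at hf₀
  obtain ⟨h₀, hh₀, hh₀1, horb⟩ := exists_iterate_perturbedShear_bounds hC₀ hA hf₀
  choose c hc0 hc using hflat (n + 2)
  set Cf : ℝ := ∑ i ∈ Finset.range (n + 1), c i with hCf
  have hCf0 : 0 ≤ Cf := Finset.sum_nonneg fun i _ => hc0 i
  have hcCf : ∀ i ≤ n, c i ≤ Cf := fun i hi =>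
    Finset.single_le_sum (fun j _ => hc0 j) (Finset.mem_range.2 (Nat.lt_succ_of_le hi))
  set B : ℝ := 2 + 2 * A with hB
  set C : ℝ := n.factorial * (Cf * 2 ^ (n + 2)) * B ^ n with hCdef
  have hB0 : 0 ≤ B := by positivity
  have hC : 0 ≤ C := by positivity
  have hD : 0 < 1 + A * C := by positivity
  refine ⟨min h₀ (1 / (1 + A * C)), lt_min hh₀ (by positivity), C, hC, ?_⟩
  intro p hp hph
  have hp1 : p.2 < h₀ := hph.trans_le (min_le_left _ _)
  have hp2 : p.2 < 1 / (1 + A * C) := hph.trans_le (min_le_right _ _)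
  rw [lt_div_iff₀ hD] at hp2
  have hp3 : p.2 ≤ 1 := hp1.le.trans hh₀1
  set X : ℝ := C * p.2 ^ 2 with hX
  have hX0 : 0 ≤ X := by positivity
  have hkX : ∀ k : ℕ, k * p.2 ≤ A → k * X ≤ 1 := by
    intro k hk
    have h1 : k * X = (k * p.2) * (C * p.2) := by rw [hX]; ring
    have h2 : (k * p.2) * (C * p.2) ≤ A * (C * p.2) := by gcongr
    nlinarith
  have step : ∀ k : ℕ, k * p.2 ≤ A →
      (∀ i, 1 ≤ i → i ≤ n →
        ‖iteratedFDeriv ℝ i (fun q => ((perturbedShear f)^[k] q).2) p‖ ≤ 1 + k * X ∧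
        ‖iteratedFDeriv ℝ i (fun q => ((perturbedShear f)^[k] q).1) p‖ ≤
          1 + k + k ^ 2 * X) →
      ∀ i ≤ n, ‖iteratedFDeriv ℝ i (f ∘ (perturbedShear f)^[k]) p‖ ≤ X := by
    intro k hk ih i hi
    have hGk := contDiff_iterate_perturbedShear hf k
    have hkX' := hkX k hk
    have hBp : 1 ≤ B / p.2 := by
      rw [le_div_iff₀ hp]
      linarith
    have hder : ∀ j, 1 ≤ j → j ≤ i →
        ‖iteratedFDeriv ℝ j (perturbedShear f)^[k] p‖ ≤ (B / p.2) ^ j := by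
      intro j hj1 hji
      obtain ⟨i1, i2⟩ := ih j hj1 (hji.trans hi)
      have h1 : ‖iteratedFDeriv ℝ j (perturbedShear f)^[k] p‖ ≤ 2 + 2 * k := by
        have h2 : (perturbedShear f)^[k] =
            fun q => (((perturbedShear f)^[k] q).1, ((perturbedShear f)^[k] q).2) := rfl
        rw [h2, iteratedFDeriv_prodMk (n := (⊤ : ℕ∞)) hGk.fst.contDiffAt hGk.snd.contDiffAt
          (by exact_mod_cast le_top), ContinuousMultilinearMap.opNorm_prod]
        have hk0 : (0 : ℝ) ≤ k := Nat.cast_nonneg k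
        refine max_le ?_ ?_
        · nlinarith
        · linarith
      refine (h1.trans ?_).trans (le_self_pow₀ hBp (by omega))
      rw [le_div_iff₀ hp]
      nlinarith
    have hfb : ∀ j ≤ i, ‖iteratedFDeriv ℝ j f ((perturbedShear f)^[k] p)‖ ≤
        Cf * (2 * p.2) ^ (n + 2) := by
      intro j hj
      obtain ⟨o1, o2, -⟩ := horb p hp hp1 k hk
      have o0 : 0 ≤ ((perturbedShear f)^[k] p).2 := by linarith
      refine (hc j _ o0).trans ?_
      have := hcCf j (hj.trans hi)
      gcongr
    refine (norm_iteratedFDeriv_comp_le hf hGk (by exact_mod_cast le_top) p hfb hder).trans ?_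
    calc (i.factorial : ℝ) * (Cf * (2 * p.2) ^ (n + 2)) * (B / p.2) ^ i
        ≤ n.factorial * (Cf * (2 * p.2) ^ (n + 2)) * (B / p.2) ^ n := by
          gcongr
      _ = X := by
          rw [hX, hCdef, mul_pow, div_pow, pow_add p.2 n 2]
          field_simp
  have bound : ∀ k : ℕ, k * p.2 ≤ A → ∀ i, 1 ≤ i → i ≤ n →
      ‖iteratedFDeriv ℝ i (fun q => ((perturbedShear f)^[k] q).2) p‖ ≤ 1 + k * X ∧
      ‖iteratedFDeriv ℝ i (fun q => ((perturbedShear f)^[k] q).1) p‖ ≤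
        1 + k + k ^ 2 * X := by
    intro k
    induction k with
    | zero =>
      intro _ i hi _
      simp only [Function.iterate_zero, id_eq, CharP.cast_eq_zero]
      constructor
      · refine ((norm_iteratedFDeriv_continuousLinearMap_le (ContinuousLinearMap.snd ℝ ℝ ℝ)
          p hi).trans (ContinuousLinearMap.norm_snd_le ..)).trans ?_
        simp
      · refine ((norm_iteratedFDeriv_continuousLinearMap_le (ContinuousLinearMap.fst ℝ ℝ ℝ)
          p hi).trans (ContinuousLinearMap.norm_fst_le ..)).trans ?_
        simp
    | succ k ih =>
      intro hk i hi1 hin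
      push_cast at hk ⊢
      have hk' : k * p.2 ≤ A := by linarith
      have hfk := step k hk' (ih hk') i hin
      obtain ⟨i1, i2⟩ := ih hk' i hi1 hin
      have hGk := contDiff_iterate_perturbedShear hf k
      have hfG : ContDiff ℝ (⊤ : ℕ∞) (f ∘ (perturbedShear f)^[k]) := hf.comp hGk
      have e2 : (fun q => ((perturbedShear f)^[k + 1] q).2) = fun q =>
          ((perturbedShear f)^[k] q).2 + ((f ∘ (perturbedShear f)^[k]) q).2 := by
        ext q; rw [Function.iterate_succ_apply']; rfl
      have e1 : (fun q => ((perturbedShear f)^[k + 1] q).1) = fun q =>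
          (((perturbedShear f)^[k] q).1 + ((perturbedShear f)^[k] q).2) +
            ((f ∘ (perturbedShear f)^[k]) q).1 := by
        ext q; rw [Function.iterate_succ_apply']; rfl
      have f1 := norm_iteratedFDeriv_fst_comp_le hfG i p
      have f2 := norm_iteratedFDeriv_snd_comp_le hfG i p
      rw [e1, e2]
      constructor
      · refine (norm_iteratedFDeriv_add_le hGk.snd hfG.snd i p).trans ?_
        linarith
      · refine (norm_iteratedFDeriv_add_le (hGk.fst.add hGk.snd) hfG.fst i p).trans ?_
        have := norm_iteratedFDeriv_add_le hGk.fst hGk.snd i p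
        have hk0 : (0 : ℝ) ≤ k * X := by positivity
        nlinarith
  exact fun k hk => step k hk (bound k hk)

/-- The eventual second coordinate along the forward orbits of a perturbed shear. -/
noncomputable def eventualHeight (f : ℝ × ℝ → ℝ × ℝ) (p : ℝ × ℝ) : ℝ :=
  limUnder atTop fun k : ℕ => ((perturbedShear f)^[k] p).2

theorem eventualHeight_perturbedShear (f : ℝ × ℝ → ℝ × ℝ) (p : ℝ × ℝ) :
    eventualHeight f (perturbedShear f p) = eventualHeight f p := by
  unfold eventualHeight limUnder
  congr 1
  conv_rhs => rw [← map_add_atTop_eq_nat 1, map_map]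
  rfl

theorem eventualHeight_eq {f : ℝ × ℝ → ℝ × ℝ} {p : ℝ × ℝ} {c : ℝ} (K : ℕ)
    (h : ∀ k, ((perturbedShear f)^[k + K] p).2 = c) : eventualHeight f p = c := by
  refine Tendsto.limUnder_eq (tendsto_const_nhds.congr' ?_)
  filter_upwards [eventually_ge_atTop K] with k hk
  rw [← h (k - K), Nat.sub_add_cancel hk]

/-- A flat perturbation of the shear supported to the left of `b` has a smooth invariant function
near `J` which is a flat perturbation of the second coordinate. -/
theorem exists_open_contDiffOn_eventualHeight {a b : ℝ} (hab : a < b) {f : ℝ × ℝ → ℝ × ℝ}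
    (hf : ContDiff ℝ (⊤ : ℕ∞) f) (h0 : ∀ p, p.2 ≤ 0 → f p = 0)
    (hb : ∀ p, b ≤ p.1 → f p = 0)
    (hflat : ∀ M n : ℕ, ∃ C, 0 ≤ C ∧
      ∀ p : ℝ × ℝ, 0 ≤ p.2 → ‖iteratedFDeriv ℝ n f p‖ ≤ C * p.2 ^ M) :
    ∃ U : Set (ℝ × ℝ), IsOpen U ∧ Jset a b ⊆ U ∧
      ContDiffOn ℝ (⊤ : ℕ∞) (fun p => eventualHeight f p - p.2) U ∧
      (∀ p ∈ U, p.2 ≤ 0 → eventualHeight f p = p.2) ∧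
      (∀ p ∈ U, 0 < p.2 → 0 < eventualHeight f p) := by
  set A : ℝ := 16 * (b - a) + 2 with hA
  have hA0 : 0 ≤ A := by linarith
  obtain ⟨C₀, hC₀, hf₀⟩ := hflat 3 0
  simp only [norm_iteratedFDeriv_zero] at hf₀
  obtain ⟨h, hh, hh1, horb⟩ := exists_iterate_perturbedShear_bounds hC₀ hA0 hf₀
  set U : Set (ℝ × ℝ) := {p | a < p.1} ∩ {p | p.2 < h} with hU
  have hUo : IsOpen U :=
    (isOpen_lt continuous_const continuous_fst).inter (isOpen_lt continuous_snd continuous_const)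
  have hneg : ∀ p : ℝ × ℝ, p.2 ≤ 0 → eventualHeight f p = p.2 := fun p hp =>
    eventualHeight_eq 0 fun k => iterate_perturbedShear_snd_of_nonpos h0 hp k
  have hloc : ∀ x ∈ U, 0 < x.2 → ∃ K : ℕ, K * x.2 ≤ A ∧
      ∀ᶠ p in 𝓝 x, eventualHeight f p = ((perturbedShear f)^[K] p).2 := by
    intro x hx hx0
    set K : ℕ := ⌈8 * (b - a) / x.2⌉₊ with hK
    have hK1 : 8 * (b - a) ≤ K * x.2 := by
      rw [← div_le_iff₀ hx0]
      exact Nat.le_ceil _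
    have hK2 : K * x.2 ≤ 8 * (b - a) + x.2 := by
      have h1 : (K : ℝ) < 8 * (b - a) / x.2 + 1 :=
        Nat.ceil_lt_add_one (div_nonneg (by linarith) hx0.le)
      have h2 := mul_lt_mul_of_pos_right h1 hx0
      rw [add_mul, div_mul_cancel₀ _ hx0.ne'] at h2
      linarith
    have hxh : x.2 < h := hx.2
    refine ⟨K, by linarith, ?_⟩
    have e1 : ∀ᶠ p : ℝ × ℝ in 𝓝 x, x.2 / 2 < p.2 :=
      continuous_snd.continuousAt.eventually_const_lt (by linarith)
    have e2 : ∀ᶠ p : ℝ × ℝ in 𝓝 x, p.2 < 2 * x.2 :=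
      continuous_snd.continuousAt.eventually_lt_const (by linarith)
    filter_upwards [e1, e2, hUo.mem_nhds hx] with p p1 p2 hp
    have hK0 : (0 : ℝ) ≤ K := Nat.cast_nonneg K
    have hp0 : 0 < p.2 := by linarith
    have hpa : a < p.1 := hp.1
    have hKp : K * p.2 ≤ A := by nlinarith
    obtain ⟨o1, -, o3⟩ := horb p hp0 hp.2 K hKp
    have hpb : b ≤ ((perturbedShear f)^[K] p).1 := by nlinarith
    refine eventualHeight_eq K fun k => ?_
    rw [Function.iterate_add_apply]
    exact (iterate_perturbedShear_snd_of_le_fst hb hpb (by linarith) k).2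
  have hJU : Jset a b ⊆ U := by
    rintro p ⟨hp1, hp2⟩
    have hp2 : p.2 = 0 := hp2
    exact ⟨hp1.1, show p.2 < h by rw [hp2]; exact hh⟩
  refine ⟨U, hUo, hJU, ?_, fun p _ => hneg p, ?_⟩
  · refine contDiffOn_of_flat hUo (fun p _ hp => by rw [hneg p hp, sub_self]) ?_ ?_
    · intro x hx
      obtain ⟨K, -, hK⟩ := hloc x hx.1 hx.2
      refine ContDiffAt.contDiffWithinAt ?_
      have := (contDiff_iterate_perturbedShear hf K).snd.sub (contDiff_snd (𝕜 := ℝ))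
      refine this.contDiffAt.congr_of_eventuallyEq ?_
      filter_upwards [hK] with p hp
      rw [hp]
    · intro n x hx hx2
      obtain ⟨h', hh', C, hC, hder⟩ := exists_norm_iteratedFDeriv_comp_iterate_le hf hflat hA0 n
      have hbound : ∀ p ∈ U, 0 < p.2 → p.2 < h' →
          ‖iteratedFDeriv ℝ n (fun p => eventualHeight f p - p.2) p‖ ≤ A * C * p.2 := by
        intro p hp hp0 hph'
        obtain ⟨K, hKA, hK⟩ := hloc p hp hp0
        have e1 : (fun p => eventualHeight f p - p.2) =ᶠ[𝓝 p]
            fun q => ((perturbedShear f)^[K] q).2 - q.2 := by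
          filter_upwards [hK] with q hq
          rw [hq]
        rw [(e1.iteratedFDeriv ℝ n).eq_of_nhds]
        have tel : ∀ k : ℕ, k * p.2 ≤ A →
            ‖iteratedFDeriv ℝ n (fun q => ((perturbedShear f)^[k] q).2 - q.2) p‖ ≤
              k * (C * p.2 ^ 2) := by
          intro k
          induction k with
          | zero => simp
          | succ k ih =>
            intro hk
            push_cast at hk ⊢
            have hk' : k * p.2 ≤ A := by linarith
            have hGk := contDiff_iterate_perturbedShear hf k
            have hfG : ContDiff ℝ (⊤ : ℕ∞) (f ∘ (perturbedShear f)^[k]) := hf.comp hGk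
            have e2 : (fun q => ((perturbedShear f)^[k + 1] q).2 - q.2) = fun q =>
                (((perturbedShear f)^[k] q).2 - q.2) +
                  ((f ∘ (perturbedShear f)^[k]) q).2 := by
              ext q
              rw [Function.iterate_succ_apply']
              simp only [perturbedShear, Function.comp_apply]
              ring
            rw [e2]
            refine (norm_iteratedFDeriv_add_le (hGk.snd.sub contDiff_snd) hfG.snd n p).trans ?_
            have f2 := norm_iteratedFDeriv_snd_comp_le hfG n p
            have f3 := hder p hp0 hph' k hk' n le_rfl
            have f4 := ih hk'
            linarith
        refine (tel K hKA).trans ?_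
        have : K * (C * p.2 ^ 2) = (K * p.2) * (C * p.2) := by ring
        rw [this, mul_assoc A C]
        gcongr
      have hlim : Tendsto (fun p : ℝ × ℝ => A * C * p.2) (𝓝[{p | 0 < p.2}] x) (𝓝 0) := by
        have : Continuous fun p : ℝ × ℝ => A * C * p.2 := by fun_prop
        have := this.tendsto x
        rw [hx2, mul_zero] at this
        exact this.mono_left nhdsWithin_le_nhds
      refine squeeze_zero' (Eventually.of_forall fun _ => norm_nonneg _) ?_ hlim
      have e3 : ∀ᶠ p : ℝ × ℝ in 𝓝 x, p.2 < h' :=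
        continuous_snd.continuousAt.eventually_lt_const (by rw [hx2]; exact hh')
      filter_upwards [self_mem_nhdsWithin, mem_nhdsWithin_of_mem_nhds (hUo.mem_nhds hx),
        mem_nhdsWithin_of_mem_nhds e3] with p q1 q2 q3
      exact hbound p q2 q1 q3
  · intro p hp hp0
    obtain ⟨K, hKA, hK⟩ := hloc p hp hp0
    rw [hK.self_of_nhds]
    linarith [(horb p hp0 hp.2 K hKA).1]

theorem exists_norm_iteratedFDeriv_le_of_hasCompactSupport {E F : Type*} [NormedAddCommGroup E]
    [NormedSpace ℝ E] [NormedAddCommGroup F] [NormedSpace ℝ F] {g : E → F}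
    (hg : ContDiff ℝ (⊤ : ℕ∞) g) (hc : HasCompactSupport g) (n : ℕ) :
    ∃ C, ∀ p, ‖iteratedFDeriv ℝ n g p‖ ≤ C :=
  (hc.iteratedFDeriv (𝕜 := ℝ) n).exists_bound_of_continuous
    (hg.continuous_iteratedFDeriv (by exact_mod_cast le_top))

/-- Cutting off a flat function to a sufficiently thin strip makes it arbitrarily `C^M`-small. -/
theorem exists_cutoff_norm_iteratedFDeriv_le {E : Type} [NormedAddCommGroup E]
    [NormedSpace ℝ E] {η : ℝ → ℝ} (hη : ContDiff ℝ (⊤ : ℕ∞) η) (hηc : HasCompactSupport η)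
    (hη2 : ∀ t, 2 ≤ |t| → η t = 0)
    {g : ℝ × ℝ → E} (hg : ContDiff ℝ (⊤ : ℕ∞) g) (hgc : HasCompactSupport g)
    (h0 : ∀ p, p.2 ≤ 0 → g p = 0) (M : ℕ) {ε : ℝ} (hε : 0 < ε) :
    ∃ δ > 0, δ ≤ 1 ∧ ∀ i ≤ M, ∀ p : ℝ × ℝ,
      ‖iteratedFDeriv ℝ i (fun q : ℝ × ℝ => η (q.2 / δ) • g q) p‖ ≤ ε := by
  choose c hc using exists_norm_iteratedFDeriv_le_of_hasCompactSupport hη hηc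
  choose d hd0 hd using exists_norm_iteratedFDeriv_le_pow hg h0
    (exists_norm_iteratedFDeriv_le_of_hasCompactSupport hg hgc) (M + 1)
  have hc0 : ∀ i, 0 ≤ c i := fun i => (norm_nonneg _).trans (hc i 0)
  set c' : ℝ := ∑ i ∈ Finset.range (M + 1), c i with hc'
  set d' : ℝ := ∑ i ∈ Finset.range (M + 1), d i with hd'
  have hc'0 : 0 ≤ c' := Finset.sum_nonneg fun i _ => hc0 i
  have hd'0 : 0 ≤ d' := Finset.sum_nonneg fun i _ => hd0 i
  have hcc' : ∀ i ≤ M, c i ≤ c' := fun i hi =>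
    Finset.single_le_sum (fun j _ => hc0 j) (Finset.mem_range.2 (Nat.lt_succ_of_le hi))
  have hdd' : ∀ i ≤ M, d i ≤ d' := fun i hi =>
    Finset.single_le_sum (fun j _ => hd0 j) (Finset.mem_range.2 (Nat.lt_succ_of_le hi))
  set B : ℝ := 2 ^ M * (M.factorial * c') * (d' * 2 ^ (M + 1)) with hB
  have hB0 : 0 ≤ B := by positivity
  have hB1 : 0 < B + 1 := by positivity
  set δ : ℝ := min 1 (ε / (B + 1)) with hδ
  have hδ0 : 0 < δ := lt_min one_pos (by positivity)
  have hδ1 : δ ≤ 1 := min_le_left _ _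
  have hδε : B * δ ≤ ε := by
    have : δ ≤ ε / (B + 1) := min_le_right _ _
    rw [le_div_iff₀ hB1] at this
    nlinarith
  have hδinv : 1 ≤ δ⁻¹ := (one_le_inv₀ hδ0).2 hδ1
  refine ⟨δ, hδ0, hδ1, fun i hi p => ?_⟩
  have hzero : (fun q : ℝ × ℝ => η (q.2 / δ) • g q) =ᶠ[𝓝 p] (fun _ => 0) →
      ‖iteratedFDeriv ℝ i (fun q : ℝ × ℝ => η (q.2 / δ) • g q) p‖ ≤ ε := by
    intro h
    rw [(h.iteratedFDeriv ℝ i).eq_of_nhds]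
    simpa using hε.le
  rcases lt_or_ge p.2 0 with hp | hp
  · refine hzero ?_
    filter_upwards [isOpen_lower_half_plane.mem_nhds hp] with q hq
    rw [h0 q (le_of_lt hq), smul_zero]
  rcases lt_or_ge (2 * δ) p.2 with hp2 | hp2
  · refine hzero ?_
    have e1 : ∀ᶠ q : ℝ × ℝ in 𝓝 p, 2 * δ < q.2 :=
      continuous_snd.continuousAt.eventually_const_lt hp2
    filter_upwards [e1] with q hq
    have : 2 ≤ q.2 / δ := (le_div_iff₀ hδ0).2 hq.le
    rw [hη2 _ (this.trans (le_abs_self _)), zero_smul]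
  set L : ℝ × ℝ →L[ℝ] ℝ := δ⁻¹ • ContinuousLinearMap.snd ℝ ℝ ℝ with hL
  have hLn : ‖L‖ ≤ δ⁻¹ := by
    rw [hL, norm_smul, Real.norm_of_nonneg (by positivity)]
    exact mul_le_of_le_one_right (by positivity) (ContinuousLinearMap.norm_snd_le ..)
  have hfun : (fun q : ℝ × ℝ => η (q.2 / δ)) = η ∘ L := by
    ext q
    simp [hL, div_eq_inv_mul]
  have hηL : ∀ j ≤ M, ‖iteratedFDeriv ℝ j (fun q : ℝ × ℝ => η (q.2 / δ)) p‖ ≤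
      M.factorial * c' * δ⁻¹ ^ M := by
    intro j hj
    rw [hfun]
    refine (norm_iteratedFDeriv_comp_le hη L.contDiff (by exact_mod_cast le_top) p
      (C := c') (D := δ⁻¹) (fun l hl => (hc l _).trans (hcc' l (hl.trans hj)))
      (fun l hl _ => ?_)).trans ?_
    · exact ((norm_iteratedFDeriv_continuousLinearMap_le L p hl).trans hLn).trans
        (le_self_pow₀ hδinv (by omega))
    · gcongr
  have hgb : ∀ j ≤ M, ‖iteratedFDeriv ℝ j g p‖ ≤ d' * (2 * δ) ^ (M + 1) := by
    intro j hj
    refine (hd j p hp).trans ?_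
    have := hdd' j hj
    gcongr
  have hηs : ContDiff ℝ (⊤ : ℕ∞) (fun q : ℝ × ℝ => η (q.2 / δ)) := by
    rw [hfun]; exact hη.comp L.contDiff
  refine (norm_iteratedFDeriv_smul_le hηs hg p (by exact_mod_cast le_top)).trans ?_
  calc ∑ j ∈ Finset.range (i + 1), (i.choose j : ℝ) *
        ‖iteratedFDeriv ℝ j (fun q : ℝ × ℝ => η (q.2 / δ)) p‖ * ‖iteratedFDeriv ℝ (i - j) g p‖
      ≤ ∑ j ∈ Finset.range (i + 1), (i.choose j : ℝ) *
        (M.factorial * c' * δ⁻¹ ^ M) * (d' * (2 * δ) ^ (M + 1)) := by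
        refine Finset.sum_le_sum fun j hj => ?_
        have hj' : j ≤ i := Nat.lt_succ_iff.1 (Finset.mem_range.1 hj)
        have h1 := hηL j (hj'.trans hi)
        have h2 := hgb (i - j) ((Nat.sub_le _ _).trans hi)
        gcongr
    _ = 2 ^ i * (M.factorial * c' * δ⁻¹ ^ M) * (d' * (2 * δ) ^ (M + 1)) := by
        rw [← Finset.sum_mul, ← Finset.sum_mul]
        congr 2
        exact_mod_cast Nat.sum_range_choose i
    _ ≤ 2 ^ M * (M.factorial * c' * δ⁻¹ ^ M) * (d' * (2 * δ) ^ (M + 1)) := by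
        gcongr
        norm_num
    _ = B * δ := by
        rw [hB, mul_pow, inv_pow, pow_succ δ M]
        field_simp
    _ ≤ ε := hδε

/-- A function that is smooth near `J` and vanishes on the lower half-plane coincides near `J`
with a compactly supported smooth function on the plane. -/
theorem exists_contDiff_hasCompactSupport_eqOn {E : Type} [NormedAddCommGroup E]
    [NormedSpace ℝ E] [CompleteSpace E] {a b : ℝ} (hab : a < b) {O : Set (ℝ × ℝ)}
    (hO : IsOpen O) (hJ : Jset a b ⊆ O) {f : ℝ × ℝ → E} (hf : ContDiffOn ℝ (⊤ : ℕ∞) f O)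
    (h0 : ∀ p ∈ O, p.2 ≤ 0 → f p = 0) :
    ∃ g : ℝ × ℝ → E, ContDiff ℝ (⊤ : ℕ∞) g ∧ HasCompactSupport g ∧
      (∀ p, p.2 ≤ 0 → g p = 0) ∧ (∀ p, p.1 ∉ Ioo a b → g p = 0) ∧
      ∃ U : Set (ℝ × ℝ), IsOpen U ∧ Jset a b ⊆ U ∧ EqOn g f U := by
  set η : ContDiffBump (0 : ℝ) := ⟨1, 2, one_pos, one_lt_two⟩ with hη
  have hη2 : ∀ t, 2 ≤ |t| → η t = 0 := fun t ht =>
    η.zero_of_le_dist (by simpa [hη, Real.dist_eq] using ht)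
  have hη1 : ∀ t, |t| ≤ 1 → η t = 1 := fun t ht =>
    η.one_of_mem_closedBall (by simpa [hη, Real.dist_eq] using ht)
  set c : ℝ := (a + b) / 2 with hc
  set r : ℕ → ℝ := fun n => (b - a) / 2 * (1 - 1 / (n + 2)) with hr
  have hr0 : ∀ n, 0 < r n := by
    intro n
    have : 1 / ((n : ℝ) + 2) < 1 := by
      rw [div_lt_one (by positivity)]
      linarith [(Nat.cast_nonneg n : (0 : ℝ) ≤ n)]
    exact mul_pos (by linarith) (by linarith)
  have hrlt : ∀ n, r n < r (n + 1) := by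
    intro n
    have : 1 / (((n + 1 : ℕ) : ℝ) + 2) < 1 / ((n : ℝ) + 2) := by
      apply one_div_lt_one_div_of_lt (by positivity)
      push_cast; linarith
    exact mul_lt_mul_of_pos_left (by linarith) (by linarith)
  have hrmono : Monotone r := monotone_nat_of_le_succ fun n => (hrlt n).le
  have hrb : ∀ n, r n < (b - a) / 2 := by
    intro n
    have : 0 < 1 / ((n : ℝ) + 2) := by positivity
    have h2 : 0 < (b - a) / 2 := by linarith
    simp only [hr]
    nlinarith
  have hrlim : Tendsto r atTop (𝓝 ((b - a) / 2)) := by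
    have h1 : Tendsto (fun n : ℕ => 1 / ((n : ℝ) + 2)) atTop (𝓝 0) := by
      have := (tendsto_one_div_add_atTop_nhds_zero_nat (𝕜 := ℝ)).comp (tendsto_add_atTop_nat 1)
      refine this.congr fun n => ?_
      simp only [Function.comp_apply]
      push_cast
      ring
    have := (h1.const_sub 1).const_mul ((b - a) / 2)
    rw [sub_zero, mul_one] at this
    exact this
  set θ : ∀ n : ℕ, ContDiffBump c := fun n => ⟨r n, r (n + 1), hr0 n, hrlt n⟩ with hθ
  have hθ1 : ∀ n t, |t - c| ≤ r n → θ n t = 1 := fun n t ht =>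
    (θ n).one_of_mem_closedBall (by simpa [hθ, Real.dist_eq] using ht)
  have hθ0 : ∀ n t, r (n + 1) ≤ |t - c| → θ n t = 0 := fun n t ht =>
    (θ n).zero_of_le_dist (by simpa [hθ, Real.dist_eq] using ht)
  set u : ℕ → ℝ → ℝ := fun n => Nat.casesOn n (fun _ => 0) (fun m => θ m) with hu
  have hus : ∀ n, ContDiff ℝ (⊤ : ℕ∞) (u n) := by
    rintro (_ | n)
    · exact contDiff_const
    · exact (θ n).contDiff
  have hu0 : ∀ n t, r n ≤ |t - c| → u n t = 0 := by
    rintro (_ | n) t ht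
    · rfl
    · exact hθ0 n t ht
  set ρ : ℕ → ℝ → ℝ := fun n t => u (n + 1) t - u n t with hρ
  have hρs : ∀ n, ContDiff ℝ (⊤ : ℕ∞) (ρ n) := fun n => (hus (n + 1)).sub (hus n)
  have hρ0 : ∀ n t, r (n + 1) ≤ |t - c| → ρ n t = 0 := fun n t ht => by
    simp only [hρ]
    rw [hu0 _ t ht, hu0 _ t ((hrlt n).le.trans ht), sub_zero]
  have hρ0' : ∀ N n t, |t - c| ≤ r N → N + 1 ≤ n → ρ n t = 0 := by
    intro N n t ht hn
    obtain ⟨m, rfl⟩ := Nat.exists_eq_add_of_le' (Nat.succ_le_iff.1 hn)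
    simp only [hρ]
    change θ (m + N + 1) t - θ (m + N) t = 0
    rw [hθ1 _ t (ht.trans (hrmono (by omega))), hθ1 _ t (ht.trans (hrmono (by omega))), sub_self]
  have hρsum : ∀ N t, |t - c| ≤ r N → ∑ n ∈ Finset.range (N + 1), ρ n t = 1 := by
    intro N t ht
    simp only [hρ]
    rw [Finset.sum_range_sub (fun n => u n t)]
    change θ N t - 0 = 1
    rw [hθ1 N t ht, sub_zero]
  have hball : ∀ t, t ∈ Ioo a b ↔ |t - c| < (b - a) / 2 := by
    intro t
    rw [abs_lt, mem_Ioo]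
    constructor <;> rintro ⟨h1, h2⟩ <;> constructor <;> linarith
  have hd : ∀ n, ∃ d > 0, ∀ p : ℝ × ℝ, |p.1 - c| ≤ r (n + 1) → |p.2| ≤ 2 * d → p ∈ O := by
    intro n
    have hsub : Metric.closedBall c (r (n + 1)) ×ˢ ({0} : Set ℝ) ⊆ O := by
      rintro p ⟨hp1, hp2⟩
      refine hJ ⟨(hball _).2 ?_, hp2⟩
      rw [Metric.mem_closedBall, Real.dist_eq] at hp1
      exact hp1.trans_lt (hrb _)
    obtain ⟨s, v, -, hv, hs, h0v, hsv⟩ :=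
      generalized_tube_lemma (isCompact_closedBall _ _) isCompact_singleton hO hsub
    obtain ⟨e, he, hev⟩ := Metric.isOpen_iff.1 hv 0 (h0v rfl)
    refine ⟨e / 3, by linarith, fun p h1 h2 => hsv ⟨hs ?_, hev ?_⟩⟩
    · rwa [Metric.mem_closedBall, Real.dist_eq]
    · rw [Metric.mem_ball, Real.dist_eq, sub_zero]; linarith
  choose d hdpos hdO using hd
  set H : ℕ → ℝ × ℝ → E := fun n p => (ρ n p.1 * η (p.2 / d n)) • f p with hH
  have hHK : ∀ n (p : ℝ × ℝ),
      p ∉ Metric.closedBall c (r (n + 1)) ×ˢ Metric.closedBall (0 : ℝ) (2 * d n) → H n p = 0 := by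
    intro n p hp
    simp only [hH]
    rw [mem_prod, not_and_or] at hp
    rcases hp with hp | hp
    · rw [Metric.mem_closedBall, not_le, Real.dist_eq] at hp
      rw [hρ0 n _ hp.le, zero_mul, zero_smul]
    · rw [Metric.mem_closedBall, not_le, Real.dist_eq, sub_zero] at hp
      rw [hη2, mul_zero, zero_smul]
      rw [abs_div, abs_of_pos (hdpos n), le_div_iff₀ (hdpos n)]
      exact hp.le
  have hHc : ∀ n, HasCompactSupport (H n) := fun n =>
    HasCompactSupport.intro ((isCompact_closedBall _ _).prod (isCompact_closedBall _ _)) fun p hp =>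
      hHK n p hp
  have hHs : ∀ n, ContDiff ℝ (⊤ : ℕ∞) (H n) := by
    intro n
    rw [contDiff_iff_contDiffAt]
    intro p
    by_cases hp : p ∈ Metric.closedBall c (r (n + 1)) ×ˢ Metric.closedBall (0 : ℝ) (2 * d n)
    · have hpO : p ∈ O := by
        refine hdO n p ?_ ?_
        · simpa [Real.dist_eq] using hp.1
        · simpa [Real.dist_eq] using hp.2
      have h1 : ContDiff ℝ (⊤ : ℕ∞) fun q : ℝ × ℝ => ρ n q.1 * η (q.2 / d n) :=
        ((hρs n).comp contDiff_fst).mul (η.contDiff.comp (contDiff_snd.div_const _))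
      exact h1.contDiffAt.smul (hf.contDiffAt (hO.mem_nhds hpO))
    · refine contDiffAt_const (c := (0 : E)) |>.congr_of_eventuallyEq ?_
      filter_upwards [(Metric.isClosed_closedBall.prod
        Metric.isClosed_closedBall).isOpen_compl.mem_nhds hp] with q hq
      exact hHK n q hq
  have hH0 : ∀ n p, p.2 ≤ 0 → H n p = 0 := by
    intro n p hp
    by_cases hp' : p ∈ Metric.closedBall c (r (n + 1)) ×ˢ Metric.closedBall (0 : ℝ) (2 * d n)
    · have hpO : p ∈ O := by
        refine hdO n p ?_ ?_
        · simpa [Real.dist_eq] using hp'.1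
        · simpa [Real.dist_eq] using hp'.2
      simp only [hH]
      rw [h0 p hpO hp, smul_zero]
    · exact hHK n p hp'
  choose δ hδ0 hδ1 hδ using fun n => exists_cutoff_norm_iteratedFDeriv_le η.contDiff
    η.hasCompactSupport hη2 (hHs n) (hHc n) (hH0 n) n (ε := (1 / 2) ^ n) (by positivity)
  set G : ℕ → ℝ × ℝ → E := fun n p => η (p.2 / δ n) • H n p with hG
  have hGs : ∀ n, ContDiff ℝ (⊤ : ℕ∞) (G n) := fun n =>
    (η.contDiff.comp (contDiff_snd.div_const _)).smul (hHs n)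
  have hsmooth : ContDiff ℝ (⊤ : ℕ∞) fun p => ∑' n, G n p := by
    refine contDiff_tsum_of_eventually (v := fun _ n => (1 / 2) ^ n) hGs
      (fun _ _ => summable_geometric_two) fun k _ => ?_
    rw [Nat.cofinite_eq_atTop]
    filter_upwards [eventually_ge_atTop k] with n hn p
    exact hδ n k hn p
  have hz : ∀ p, (∀ n, G n p = 0) → ∑' n, G n p = 0 := fun p hp => by simp [hp]
  have hz1 : ∀ p : ℝ × ℝ, p.1 ∉ Ioo a b → ∑' n, G n p = 0 := by
    intro p hp
    refine hz p fun n => ?_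
    simp only [hG, hH]
    rw [hball, not_lt] at hp
    rw [hρ0 n _ ((hrb _).le.trans hp), zero_mul, zero_smul, smul_zero]
  refine ⟨fun p => ∑' n, G n p, hsmooth, ?_, ?_, hz1, ?_⟩
  · refine HasCompactSupport.intro (K := Icc a b ×ˢ Metric.closedBall (0 : ℝ) 2)
      (isCompact_Icc.prod (isCompact_closedBall _ _)) fun p hp => ?_
    rw [mem_prod, not_and_or] at hp
    rcases hp with hp | hp
    · exact hz1 p fun h => hp (Ioo_subset_Icc_self h)
    · refine hz p fun n => ?_
      rw [Metric.mem_closedBall, not_le, Real.dist_eq, sub_zero] at hp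
      simp only [hG]
      rw [hη2, zero_smul]
      rw [abs_div, abs_of_pos (hδ0 n), le_div_iff₀ (hδ0 n)]
      nlinarith [hδ1 n]
  · intro p hp
    refine hz p fun n => ?_
    simp only [hG]
    rw [hH0 n p hp, smul_zero]
  · refine ⟨interior {p | ∑' n, G n p = f p}, isOpen_interior, ?_, fun p hp =>
      interior_subset (s := {p | ∑' n, G n p = f p}) hp⟩
    rintro x ⟨hx1, hx2⟩
    have hx2 : x.2 = 0 := hx2
    rw [mem_interior_iff_mem_nhds]
    obtain ⟨N, hN⟩ := (hrlim.eventually_const_lt ((hball _).1 hx1)).exists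
    have e1 : ∀ᶠ p : ℝ × ℝ in 𝓝 x, |p.1 - c| < r N := by
      have : Continuous fun p : ℝ × ℝ => |p.1 - c| := by fun_prop
      exact this.continuousAt.eventually_lt_const hN
    have e2 : ∀ e : ℝ, 0 < e → ∀ᶠ p : ℝ × ℝ in 𝓝 x, |p.2| < e := by
      intro e he
      have : Continuous fun p : ℝ × ℝ => |p.2| := by fun_prop
      exact this.continuousAt.eventually_lt_const (by simpa [hx2] using he)
    have e3 : ∀ᶠ p : ℝ × ℝ in 𝓝 x, ∀ n ∈ Finset.range (N + 1), |p.2| < d n ∧ |p.2| < δ n := by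
      rw [Filter.eventually_all_finset]
      exact fun n _ => (e2 _ (hdpos n)).and (e2 _ (hδ0 n))
    filter_upwards [e1, e3] with p h1 h3
    rw [tsum_eq_sum (s := Finset.range (N + 1))]
    · have : ∀ n ∈ Finset.range (N + 1), G n p = ρ n p.1 • f p := by
        intro n hn
        simp only [hG, hH]
        obtain ⟨h4, h5⟩ := h3 n hn
        rw [hη1 (p.2 / δ n), hη1 (p.2 / d n), one_smul, mul_one]
        · rw [abs_div, abs_of_pos (hdpos n), div_le_one (hdpos n)]
          exact h4.le
        · rw [abs_div, abs_of_pos (hδ0 n), div_le_one (hδ0 n)]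
          exact h5.le
      rw [Finset.sum_congr rfl this, ← Finset.sum_smul, hρsum N _ h1.le, one_smul]
    · intro n hn
      simp only [hG, hH]
      rw [hρ0' N n _ h1.le (by simpa using hn), zero_mul, zero_smul, smul_zero]

/-- A domain adjacent to `J` contains the upper half of some open neighbourhood of `J`. -/
theorem exists_open_inter_upper_subset {a b : ℝ} {V : Set (ℝ × ℝ)} (hV : IsAdjDomain a b V) :
    ∃ O : Set (ℝ × ℝ), IsOpen O ∧ Jset a b ⊆ O ∧ (∀ p ∈ O, p.1 ∈ Ioo a b) ∧
      ∀ p ∈ O, 0 < p.2 → p ∈ V := by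
  refine ⟨interior {p | p.1 ∈ Ioo a b ∧ (0 < p.2 → p ∈ V)}, isOpen_interior, fun x hx => ?_,
    fun p hp => (interior_subset hp).1, fun p hp => (interior_subset hp).2⟩
  obtain ⟨ε, hε, hεV⟩ := hV.2.2.2 x.1 hx.1
  have hx2 : x.2 = 0 := hx.2
  rw [mem_interior_iff_mem_nhds]
  filter_upwards [continuous_fst.continuousAt.eventually (isOpen_Ioo.mem_nhds hx.1),
    continuous_fst.continuousAt.eventually (isOpen_Ioo.mem_nhds
      (show x.1 ∈ Ioo (x.1 - ε) (x.1 + ε) from ⟨by linarith, by linarith⟩)),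
    continuous_snd.continuousAt.eventually_lt_const (show x.2 < ε by rw [hx2]; exact hε)]
    with p h1 h2 h3
  exact ⟨h1, fun h4 => hεV ⟨h2, h4, h3⟩⟩

/-- A flat function extends by zero to a smooth function on a two-sided neighbourhood of `J`. -/
theorem contDiffOn_ite_of_flatOn {a b : ℝ} {V O : Set (ℝ × ℝ)} (hV : IsOpen V) (hO : IsOpen O)
    (hOab : ∀ p ∈ O, p.1 ∈ Ioo a b) (hOV : ∀ p ∈ O, 0 < p.2 → p ∈ V) {f : ℝ × ℝ → ℝ}
    (hf : ContDiffOn ℝ (⊤ : ℕ∞) f V) (hflat : FlatOn a b (V ∪ Jset a b) f) :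
    ContDiffOn ℝ (⊤ : ℕ∞) (fun p => if 0 < p.2 then f p else 0) O := by
  have hev : ∀ p : ℝ × ℝ, 0 < p.2 → (fun p => if 0 < p.2 then f p else 0) =ᶠ[𝓝 p] f := by
    intro p hp
    filter_upwards [isOpen_upper_half_plane.mem_nhds hp] with q hq
    exact if_pos hq
  refine contDiffOn_of_flat hO (fun p _ hp => if_neg (not_lt.2 hp)) ?_ fun n x hx hx2 => ?_
  · refine (hf.mono fun p hp => hOV p hp.1 hp.2).congr fun p hp => if_pos hp.2
  · rw [Metric.tendsto_nhds]
    intro ε hε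
    obtain ⟨r, hr, hrab⟩ := Metric.nhds_basis_closedBall.mem_iff.1
      (isOpen_Ioo.mem_nhds (hOab x hx))
    obtain ⟨δ, hδ, hδf⟩ := hflat.2 n _ (isCompact_closedBall x.1 r) hrab ε hε
    filter_upwards [self_mem_nhdsWithin, mem_nhdsWithin_of_mem_nhds (hO.mem_nhds hx),
      mem_nhdsWithin_of_mem_nhds (continuous_fst.continuousAt.eventually
        (Metric.closedBall_mem_nhds x.1 hr)),
      mem_nhdsWithin_of_mem_nhds (continuous_snd.continuousAt.eventually_lt_const
        (show x.2 < δ by rw [hx2]; exact hδ))] with p hp hpO hp1 hp2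
    have hpV : p ∈ V := hOV p hpO hp
    have := hδf p (Or.inl hpV) hp1 hp2
    have hmem : V ∪ Jset a b ∈ 𝓝 p := mem_of_superset (hV.mem_nhds hpV) subset_union_left
    rw [iteratedFDerivWithin_congr_set (eventuallyEq_univ.2 hmem),
      iteratedFDerivWithin_univ] at this
    rw [Real.dist_eq, sub_zero, abs_norm, ((hev p hp).iteratedFDeriv ℝ n).eq_of_nhds]
    exact this

/-- A map that is a flat perturbation of the shear coincides, near `J`, with a globally defined
perturbed shear. -/
theorem exists_eq_perturbedShear {a b : ℝ} (hab : a < b) {V : Set (ℝ × ℝ)}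
    (hV : IsAdjDomain a b V) {F : ℝ × ℝ → ℝ × ℝ}
    (hF : ContDiffOn ℝ (⊤ : ℕ∞) F (V ∪ Jset a b))
    (hf1 : FlatOn a b (V ∪ Jset a b) (fun p => (F p).1 - p.1 - p.2))
    (hf2 : FlatOn a b (V ∪ Jset a b) (fun p => (F p).2 - p.2)) :
    ∃ f : ℝ × ℝ → ℝ × ℝ, ContDiff ℝ (⊤ : ℕ∞) f ∧ HasCompactSupport f ∧
      (∀ p, p.2 ≤ 0 → f p = 0) ∧ (∀ p, p.1 ∉ Ioo a b → f p = 0) ∧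
      ∃ U : Set (ℝ × ℝ), IsOpen U ∧ Jset a b ⊆ U ∧ (∀ p ∈ U, 0 < p.2 → p ∈ V) ∧
        ∀ p ∈ U, 0 ≤ p.2 → F p = perturbedShear f p := by
  obtain ⟨O, hO, hJO, hOab, hOV⟩ := exists_open_inter_upper_subset hV
  have hFV : ContDiffOn ℝ (⊤ : ℕ∞) F V := hF.mono subset_union_left
  have h1 := contDiffOn_ite_of_flatOn hV.1 hO hOab hOV
    ((hFV.fst.sub contDiffOn_fst).sub contDiffOn_snd) hf1
  have h2 := contDiffOn_ite_of_flatOn hV.1 hO hOab hOV (hFV.snd.sub contDiffOn_snd) hf2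
  obtain ⟨f, hfs, hfc, hf0, hfab, U, hU, hJU, hUf⟩ :=
    exists_contDiff_hasCompactSupport_eqOn hab hO hJO (h1.prodMk h2)
      (fun p _ hp => by simp [not_lt.2 hp])
  refine ⟨f, hfs, hfc, hf0, hfab, U ∩ O, hU.inter hO, subset_inter hJU hJO,
    fun p hp => hOV p hp.2, fun p hp hp0 => ?_⟩
  rcases hp0.eq_or_lt with h | h
  · have hs := hOab p hp.2
    have e : p = (p.1, 0) := Prod.ext rfl h.symm
    have e1 := hf1.1 p.1 hs
    have e2 := hf2.1 p.1 hs
    rw [← e] at e1 e2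
    simp only [perturbedShear, hf0 p h.ge]
    ext
    · simp; linarith
    · simp; linarith
  · have := hUf hp.1
    simp only [h, if_true] at this
    simp only [perturbedShear, this]
    ext <;> simp

/-- For a `C^∞` map `F̃(τ,φ) = (τ + φ + flat(φ), φ + flat(φ))` on a domain
`V` adjacent to `J`, there exist a domain `W ⊆ V` adjacent to `J` and a family
`(φ̃_ε)_{ε ∈ [0,1]}` of `C^∞`-smooth `F̃`-invariant functions on `W ∪ J` with
`φ̃_ε − φ` `φ`-flat and `∂φ̃_ε/∂φ > 0`, such that for `ε ≠ ε'` the germs of `φ̃_ε` and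
`φ̃_{ε'}` at every point of `J` are distinct. -/
theorem statement2 (a b : ℝ) (hab : a < b)
    (V : Set (ℝ × ℝ)) (hV : IsAdjDomain a b V)
    (F : ℝ × ℝ → ℝ × ℝ)
    (hFsmooth : ContDiffOn ℝ (⊤ : ℕ∞) F (V ∪ Jset a b))
    (hFmaps : ∀ p ∈ V ∪ Jset a b, 0 ≤ (F p).2)
    (hf1 : FlatOn a b (V ∪ Jset a b) (fun p => (F p).1 - p.1 - p.2))
    (hf2 : FlatOn a b (V ∪ Jset a b) (fun p => (F p).2 - p.2)) :
    ∃ W : Set (ℝ × ℝ), W ⊆ V ∧ IsAdjDomain a b W ∧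
      ∃ φt : ℝ → (ℝ × ℝ → ℝ),
        (∀ ε ∈ Set.Icc (0:ℝ) 1,
          ContDiffOn ℝ (⊤ : ℕ∞) (φt ε) (W ∪ Jset a b) ∧
          (∀ p ∈ W ∪ Jset a b, F p ∈ W ∪ Jset a b → φt ε (F p) = φt ε p) ∧
          FlatOn a b (W ∪ Jset a b) (fun p => φt ε p - p.2) ∧
          (∀ p ∈ W ∪ Jset a b,
            0 < fderivWithin ℝ (φt ε) (W ∪ Jset a b) p (0, 1))) ∧
        -- distinct germs at every point of `J`:
        (∀ ε ∈ Set.Icc (0:ℝ) 1, ∀ ε' ∈ Set.Icc (0:ℝ) 1, ε ≠ ε' →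
          ∀ x ∈ Jset a b, ¬ ∃ U ∈ nhds x,
            Set.EqOn (φt ε) (φt ε') (U ∩ (W ∪ Jset a b))) := by
  obtain ⟨f, hfs, hfc, hf0, hfab, U₁, hU₁, hJU₁, hU₁V, hFf⟩ :=
    exists_eq_perturbedShear hab hV hFsmooth hf1 hf2
  obtain ⟨U₂, hU₂, hJU₂, hψ, hneg, hpos⟩ := exists_open_contDiffOn_eventualHeight hab hfs hf0
    (fun p hp => hfab p fun h => (h.2.trans_le hp).false)
    (fun M n => exists_norm_iteratedFDeriv_le_pow hfs hf0
      (exists_norm_iteratedFDeriv_le_of_hasCompactSupport hfs hfc) M n)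
  have hH : ContDiffOn ℝ (⊤ : ℕ∞) (eventualHeight f) U₂ :=
    (hψ.add contDiffOn_snd).congr fun p _ => by simp
  have hχ : ContDiffOn ℝ (⊤ : ℕ∞) (fun p => expNegInvGlue (eventualHeight f p)) U₂ :=
    (expNegInvGlue.contDiff (n := (⊤ : ℕ∞))).comp_contDiffOn hH
  have hψ0 : ∀ p ∈ U₂, p.2 ≤ 0 → eventualHeight f p - p.2 = 0 := fun p hp hp2 => by
    rw [hneg p hp hp2, sub_self]
  have hχ0 : ∀ p ∈ U₂, p.2 ≤ 0 → expNegInvGlue (eventualHeight f p) = 0 := fun p hp hp2 => by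
    rw [hneg p hp hp2, expNegInvGlue.zero_of_nonpos hp2]
  obtain ⟨N₁, hN₁, hJN₁, hψN⟩ := exists_open_norm_fderiv_lt hU₂ hJU₂ hψ hψ0 one_half_pos
  obtain ⟨N₂, hN₂, hJN₂, hχN⟩ := exists_open_norm_fderiv_lt hU₂ hJU₂ hχ hχ0 one_half_pos
  obtain ⟨W, hW, hWO, hWu⟩ := exists_adjDomain_subset hab
    ((hU₁.inter hU₂).inter (hN₁.inter hN₂))
    (subset_inter (subset_inter hJU₁ hJU₂) (subset_inter hJN₁ hJN₂))
  have hS0 : ∀ p ∈ W ∪ Jset a b, 0 ≤ p.2 := by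
    rintro p (hp | hp)
    · exact (hW.2.2.1 p hp).le
    · exact (show p.2 = 0 from hp.2).ge
  have hSU : W ∪ Jset a b ⊆ U₂ := fun p hp => (hWO hp).1.2
  refine ⟨W, fun p hp => hU₁V p (hWO (Or.inl hp)).1.1 (hW.2.2.1 p hp), hW,
    fun ε p => eventualHeight f p + ε * expNegInvGlue (eventualHeight f p), fun ε hε => ?_, ?_⟩
  · have hs : ContDiffOn ℝ (⊤ : ℕ∞)
        (fun p => eventualHeight f p + ε * expNegInvGlue (eventualHeight f p)) U₂ :=
      hH.add (contDiffOn_const.mul hχ)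
    refine ⟨hs.mono hSU, fun p hp _ => ?_, ?_, fun p hp => ?_⟩
    · beta_reduce
      rw [hFf p (hWO hp).1.1 (hS0 p hp), eventualHeight_perturbedShear]
    · refine flatOn_of_contDiffOn hU₂ hSU hJU₂ hWu hS0 (hs.sub contDiffOn_snd) fun p hp hp2 => ?_
      beta_reduce
      rw [hχ0 p hp hp2, mul_zero, add_zero, hψ0 p hp hp2]
    · have hp₂ : U₂ ∈ 𝓝 p := hU₂.mem_nhds (hSU hp)
      have dψ := ((hψ.contDiffAt hp₂).differentiableAt (by simp)).hasFDerivAt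
      have dχ := ((hχ.contDiffAt hp₂).differentiableAt (by simp)).hasFDerivAt
      have dsum := (dψ.add (hasFDerivAt_snd (𝕜 := ℝ) (p := p))).add (dχ.const_mul ε)
      have d := dsum.congr_of_eventuallyEq
        (f₁ := fun p => eventualHeight f p + ε * expNegInvGlue (eventualHeight f p))
        (Eventually.of_forall fun q => by simp)
      rw [d.hasFDerivWithinAt.fderivWithin (hWu p hp)]
      have hv : ‖((0 : ℝ), (1 : ℝ))‖ = 1 := by simp [Prod.norm_def]
      have hψ1 := (ContinuousLinearMap.le_opNorm
        (fderiv ℝ (fun p => eventualHeight f p - p.2) p) (0, 1))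
      have hχ1 := (ContinuousLinearMap.le_opNorm
        (fderiv ℝ (fun p => expNegInvGlue (eventualHeight f p)) p) (0, 1))
      rw [hv, mul_one] at hψ1 hχ1
      have hψ2 := abs_lt.1 (hψ1.trans_lt (hψN p (hWO hp).2.1))
      have hχ2 := abs_lt.1 (hχ1.trans_lt (hχN p (hWO hp).2.2))
      simp only [add_apply, smul_apply,
        ContinuousLinearMap.coe_snd', smul_eq_mul]
      nlinarith [hε.1, hε.2, hψ2.1, hχ2.1, mul_le_mul_of_nonneg_left hχ2.1.le hε.1]
  · rintro ε - ε' - hne x hx ⟨N, hN, heq⟩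
    have hx2 : x.2 = 0 := hx.2
    obtain ⟨e, he, heW⟩ := hW.2.2.2 x.1 hx.1
    have hlim : Tendsto (fun t : ℝ => (x.1, t)) (𝓝[>] 0) (𝓝 x) := by
      have : Continuous fun t : ℝ => (x.1, t) := by fun_prop
      refine (this.tendsto' 0 x ?_).mono_left nhdsWithin_le_nhds
      exact Prod.ext rfl hx2.symm
    obtain ⟨t, htN, ht⟩ := ((hlim.eventually hN).and (Ioo_mem_nhdsGT he)).exists
    have htW : (x.1, t) ∈ W := heW ⟨⟨by linarith, by linarith⟩, ht⟩
    have hE := expNegInvGlue.pos_of_pos (hpos (x.1, t) (hSU (Or.inl htW)) ht.1)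
    have := heq ⟨htN, Or.inl htW⟩
    exact hne (mul_right_cancel₀ hE.ne' (add_left_cancel this))
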